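/- arXiv:1512.00518 — 10 statements merged into one kernel-verified Lean document; each statement's English description precedes it below -/
import Mathlib

section
/- Let Ω ⊂ ℝ³ be a bounded open set, D ⊂ ℝ³ a nonempty open set with closure(D) ⊆ Ω, and p ∈ ℝ³ \ closure(Ω). Then closure(D) ⊆ E_p, i.e. for every x ∈ closure(D) and every y ∈ ∂Ω one has ‖p − x‖ + ‖x − y‖ ≥ l(p, D). -/
/-- A segment from a point of `closure s` to a point outside `closure s` meets `frontier s`. -/
theorem exists_mem_segment_mem_frontier {E : Type*} [NormedAddCommGroup E] [NormedSpace ℝ E]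
    {s : Set E} {a b : E} (ha : a ∈ closure s) (hb : b ∉ closure s) :
    ∃ z ∈ segment ℝ a b, z ∈ frontier s := by
  by_contra! h
  have hcover : segment ℝ a b ⊆ interior s ∪ (closure s)ᶜ := fun z hz => by
    by_contra hzu
    rw [Set.mem_union, not_or, Set.notMem_compl_iff] at hzu
    exact h z hz ⟨hzu.2, hzu.1⟩
  have ha' : a ∈ interior s := (hcover (left_mem_segment ℝ a b)).resolve_right (not_not.2 ha)
  obtain ⟨z, -, hzi, hzc⟩ := (convex_segment a b).isPreconnected _ _ isOpen_interior
    isClosed_closure.isOpen_compl hcover ⟨a, left_mem_segment ℝ a b, ha'⟩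
    ⟨b, right_mem_segment ℝ a b, hb⟩
  exact hzc (interior_subset_closure hzi)

/-- every point of `closure D` lies in the enclosing region `E_p`, i.e.
for all `x ∈ closure D` and `y ∈ frontier Ω`, `‖p - x‖ + ‖x - y‖ ≥ l(p, D)`. -/
theorem stmt_0
    (Ω D : Set (EuclideanSpace ℝ (Fin 3))) (p : EuclideanSpace ℝ (Fin 3))
    (hΩo : IsOpen Ω) (hΩb : Bornology.IsBounded Ω)
    (hDo : IsOpen D) (hDne : D.Nonempty) (hDΩ : closure D ⊆ Ω)
    (hp : p ∉ closure Ω)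
    (x : EuclideanSpace ℝ (Fin 3)) (hx : x ∈ closure D)
    (y : EuclideanSpace ℝ (Fin 3)) (hy : y ∈ frontier Ω) :
    ‖p - x‖ + ‖x - y‖ ≥
      sInf {l : ℝ | ∃ x' ∈ frontier D, ∃ y' ∈ frontier Ω,
        l = ‖p - x'‖ + ‖x' - y'‖} := by
  obtain ⟨z, hz, hzD⟩ := exists_mem_segment_mem_frontier hx
    fun h => hp (subset_closure (hDΩ h))
  have hbdd : BddBelow {l : ℝ | ∃ x' ∈ frontier D, ∃ y' ∈ frontier Ω,
      l = ‖p - x'‖ + ‖x' - y'‖} := by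
    refine ⟨0, ?_⟩
    rintro l ⟨x', -, y', -, rfl⟩
    positivity
  refine (csInf_le hbdd ⟨z, hzD, y, hy, rfl⟩).trans ?_
  have hadd := dist_add_dist_of_mem_segment hz
  have htri := dist_triangle z x y
  simp only [← dist_eq_norm]
  linarith [dist_comm x z, dist_comm z p, dist_comm x p]
end

section
/- Let Ω ⊂ ℝ³ be a bounded open set, D ⊂ ℝ³ a nonempty open set with closure(D) ⊆ Ω, and p ∈ ℝ³ \ closure(Ω). Then E_p ∩ Ω ⊆ R_p; that is, every x ∈ Ω satisfying ‖p − x‖ + ‖x − y‖ ≥ l(p, D) for all y ∈ ∂Ω also satisfies 2‖p − x‖ ≥ l(p, D) + dist(p, ∂Ω). -/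
/-- `E_p ∩ Ω ⊆ R_p`: every `x ∈ Ω` with
`‖p - x‖ + ‖x - y‖ ≥ l(p, D)` for all `y ∈ frontier Ω` satisfies
`2‖p - x‖ ≥ l(p, D) + dist(p, frontier Ω)`. -/
theorem stmt_1
    (Ω D : Set (EuclideanSpace ℝ (Fin 3))) (p : EuclideanSpace ℝ (Fin 3))
    (hΩo : IsOpen Ω) (hΩb : Bornology.IsBounded Ω)
    (hDo : IsOpen D) (hDne : D.Nonempty) (hDΩ : closure D ⊆ Ω)
    (hp : p ∉ closure Ω)
    (x : EuclideanSpace ℝ (Fin 3)) (hx : x ∈ Ω)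
    (hxE : ∀ y ∈ frontier Ω,
      ‖p - x‖ + ‖x - y‖ ≥
        sInf {l : ℝ | ∃ x' ∈ frontier D, ∃ y' ∈ frontier Ω,
          l = ‖p - x'‖ + ‖x' - y'‖}) :
    2 * ‖p - x‖ ≥
      (sInf {l : ℝ | ∃ x' ∈ frontier D, ∃ y' ∈ frontier Ω,
        l = ‖p - x'‖ + ‖x' - y'‖}) +
      sInf {d : ℝ | ∃ y ∈ frontier Ω, d = ‖p - y‖} := by
  obtain ⟨y, hy, hyΩ⟩ : (segment ℝ p x ∩ frontier Ω).Nonempty := by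
    by_contra hne
    have hcover : segment ℝ p x ⊆ Ω ∪ (closure Ω)ᶜ := fun z hz => by
      by_contra hz'
      rw [Set.mem_union, Set.mem_compl_iff, not_or, not_not] at hz'
      exact hne ⟨z, hz, hΩo.frontier_eq ▸ ⟨hz'.2, hz'.1⟩⟩
    obtain ⟨z, -, hzΩ, hzc⟩ := (convex_segment p x).isPreconnected Ω (closure Ω)ᶜ hΩo
      isClosed_closure.isOpen_compl hcover ⟨x, right_mem_segment ℝ p x, hx⟩
      ⟨p, left_mem_segment ℝ p x, hp⟩
    exact hzc (subset_closure hzΩ)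
  have hadd : ‖p - y‖ + ‖x - y‖ = ‖p - x‖ := by
    simpa only [dist_eq_norm, norm_sub_rev y x] using dist_add_dist_of_mem_segment hy
  have hdist : sInf {d : ℝ | ∃ y ∈ frontier Ω, d = ‖p - y‖} ≤ ‖p - y‖ := by
    refine csInf_le ⟨0, ?_⟩ ⟨y, hyΩ, rfl⟩
    rintro d ⟨z, -, rfl⟩
    exact norm_nonneg _
  linarith [hxE y hyΩ]
end

section
/- Let S ⊂ ℝ³, x ∈ S, p ∈ ℝ³ with p ≠ x, and let ν ∈ ℝ³ be a unit vector such that ⟨z − x, ν⟩ < 0 for every z ∈ S with z ≠ x (strict supporting-hyperplane condition at x). If ⟨p − x, ν⟩ ≥ 0, then for every z ∈ S with z ≠ x one has ‖p − z‖ + ‖z − x‖ > ‖p − x‖; in particular the function z ↦ ‖p − z‖ + ‖z − x‖ on S attains its minimum only at z = x. -/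
open scoped RealInnerProductSpace

/-- if `ν` is a strict supporting normal of `S` at `x` and
`⟪p - x, ν⟫ ≥ 0`, then `z ↦ ‖p - z‖ + ‖z - x‖` on `S` attains its minimum
only at `z = x`. -/
theorem stmt_3 (S : Set (EuclideanSpace ℝ (Fin 3)))
    (x p ν : EuclideanSpace ℝ (Fin 3))
    (hx : x ∈ S) (hpx : p ≠ x) (hν : ‖ν‖ = 1)
    (hsupp : ∀ z ∈ S, z ≠ x → ⟪z - x, ν⟫ < 0)
    (hp : 0 ≤ ⟪p - x, ν⟫) :
    ∀ z ∈ S, z ≠ x → ‖p - z‖ + ‖z - x‖ > ‖p - x‖ := by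
  intro z hz hzx
  by_contra! hle
  have hsum : p - z + (z - x) = p - x := sub_add_sub_cancel p z x
  have hray : SameRay ℝ (z - x) (p - z) := by
    refine (sameRay_iff_norm_add.2 ?_).symm
    exact le_antisymm (norm_add_le _ _) (hsum ▸ hle)
  obtain ⟨r, hr, hrz⟩ := hray.exists_nonneg_left (sub_ne_zero.2 hzx)
  have hneg := hsupp z hz hzx
  rw [← hsum, ← hrz, inner_add_left, real_inner_smul_left] at hp
  nlinarith
end

section
/- Let D ⊂ ℝ³ be a nonempty open bounded convex set whose frontier ∂D contains no three distinct collinear points (strict convexity). Let x ∈ ∂D and p ∈ ℝ³ \ closure(D), and suppose the open segment joining p and x meets D. Then ∂D meets the open segment joining p and x in exactly one point x*, and the set of minimizers of the function z ↦ ‖p − z‖ + ‖z − x‖ over ∂D is exactly {x, x*}, the minimum value being ‖p − x‖. -/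
theorem IsPreconnected.inter_frontier_nonempty {X : Type*} [TopologicalSpace X] {s t : Set X}
    (hs : IsPreconnected s) (ht : IsOpen t) (hst : (s ∩ t).Nonempty)
    (hst' : (s ∩ (closure t)ᶜ).Nonempty) : (s ∩ frontier t).Nonempty := by
  by_contra hne
  obtain ⟨z, -, hzt, hzt'⟩ := hs t (closure t)ᶜ ht isClosed_closure.isOpen_compl
    (fun z hz => by
      by_contra hz'
      rw [Set.mem_union, not_or, Set.notMem_compl_iff] at hz'
      exact hne ⟨z, hz, hz'.2, ht.interior_eq.symm ▸ hz'.1⟩) hst hst'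
  exact hzt' (subset_closure hzt)

/-- for a strictly convex body `D`, a boundary point `x`, and an
exterior point `p` whose open segment to `x` meets `D`, the frontier meets the
open segment `p x` in exactly one point `xs`, and the minimizers of
`z ↦ ‖p - z‖ + ‖z - x‖` over `frontier D` are exactly `{x, xs}`, the minimum
value being `‖p - x‖`. -/
theorem stmt_4 (D : Set (EuclideanSpace ℝ (Fin 3)))
    (hDo : IsOpen D) (hDne : D.Nonempty) (hDb : Bornology.IsBounded D)
    (hDc : Convex ℝ D)
    (hstrict : ∀ a ∈ frontier D, ∀ b ∈ frontier D, ∀ c ∈ frontier D,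
      a ≠ b → b ≠ c → a ≠ c →
        ¬ Collinear ℝ ({a, b, c} : Set (EuclideanSpace ℝ (Fin 3))))
    (x : EuclideanSpace ℝ (Fin 3)) (hx : x ∈ frontier D)
    (p : EuclideanSpace ℝ (Fin 3)) (hp : p ∉ closure D)
    (hseg : (openSegment ℝ p x ∩ D).Nonempty) :
    ∃ xs : EuclideanSpace ℝ (Fin 3),
      frontier D ∩ openSegment ℝ p x = {xs} ∧
      (∀ z ∈ frontier D, ‖p - x‖ ≤ ‖p - z‖ + ‖z - x‖) ∧
      {z | z ∈ frontier D ∧ ‖p - z‖ + ‖z - x‖ = ‖p - x‖} = {x, xs} := by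
  have hpx : p ≠ x := fun h => hp (h ▸ frontier_subset_closure hx)
  have hne : ∀ z ∈ openSegment ℝ p x, z ≠ x := by
    rintro z hz rfl
    exact hpx (right_mem_openSegment_iff.mp hz)
  have hseg_frontier : ∀ z ∈ segment ℝ p x, z ∈ frontier D → z ≠ x → z ∈ openSegment ℝ p x :=
    fun z hz hzD hzx => mem_openSegment_of_ne_left_right
      (fun h => hp (h ▸ frontier_subset_closure hzD)) hzx.symm hz
  obtain ⟨y, hy, hyD⟩ := hseg
  obtain ⟨xs, hxs, hxsD⟩ := (convex_segment p y).isPreconnected.inter_frontier_nonempty hDo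
    ⟨y, right_mem_segment ℝ p y, hyD⟩ ⟨p, left_mem_segment ℝ p y, hp⟩
  have hxs_seg : xs ∈ segment ℝ p x :=
    (convex_segment p x).segment_subset (left_mem_segment ℝ p x)
      (openSegment_subset_segment ℝ p x hy) hxs
  have hxs_ne : xs ≠ x := by
    rintro rfl
    rw [mem_segment_iff_wbtw] at hxs
    have hyw : Wbtw ℝ p y xs := mem_segment_iff_wbtw.mp (openSegment_subset_segment ℝ p xs hy)
    exact hne y hy ((wbtw_swap_right_iff ℝ p).mp ⟨hyw, hxs⟩)
  have hxs_open := hseg_frontier xs hxs_seg hxsD hxs_ne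
  have huniq : ∀ z ∈ frontier D, z ∈ openSegment ℝ p x → z = xs := by
    intro z hzD hz
    by_contra hzxs
    refine hstrict z hzD xs hxsD x hx hzxs hxs_ne (hne z hz) ?_
    have hline : ∀ w ∈ segment ℝ p x, w ∈ line[ℝ, p, x] := fun w hw =>
      (mem_segment_iff_wbtw.mp hw).mem_affineSpan
    exact collinear_triple_of_mem_affineSpan_pair
      (hline z (openSegment_subset_segment ℝ p x hz)) (hline xs hxs_seg)
      (right_mem_affineSpan_pair ℝ p x)
  have hmin : ∀ z, ‖p - z‖ + ‖z - x‖ = ‖p - x‖ ↔ z ∈ segment ℝ p x := fun z => by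
    rw [← dist_eq_norm, ← dist_eq_norm, ← dist_eq_norm, dist_add_dist_eq_iff,
      mem_segment_iff_wbtw]
  refine ⟨xs, ?_, fun z _ => norm_sub_le_norm_sub_add_norm_sub p z x, ?_⟩
  · ext z
    exact ⟨fun hz => huniq z hz.1 hz.2, by rintro rfl; exact ⟨hxsD, hxs_open⟩⟩
  · ext z
    simp only [Set.mem_ofPred_eq, Set.mem_insert_iff, Set.mem_singleton_iff, hmin]
    constructor
    · rintro ⟨hzD, hz⟩
      exact or_iff_not_imp_left.mpr fun hzx => huniq z hzD (hseg_frontier z hz hzD hzx)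
    · rintro (rfl | rfl)
      · exact ⟨hx, right_mem_segment ℝ p z⟩
      · exact ⟨hxsD, hxs_seg⟩
end

section
/- Let S ⊂ ℝ³, x ∈ S, p ∈ ℝ³ with p ≠ x, and let ν ∈ ℝ³ be a unit vector such that ⟨z − x, ν⟩ ≤ 0 for every z ∈ S. Set α = ⟨p − x, ν⟩ / ‖p − x‖ and assume α > 0. Then for every z ∈ S one has ‖p − z‖ + ‖z − x‖ ≥ ‖p − x‖ + (min{α², 2} / 2) · ‖z − x‖. -/
open scoped RealInnerProductSpace

section HalfSpace

variable {E : Type*} [NormedAddCommGroup E] [InnerProductSpace ℝ E]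

/-- If `v` lies in the half-space opposite to the unit vector `ν`, and the cosine `a` of the angle
between `u` and `ν` is nonnegative, then the cosine of the angle between `u` and `v` is at most
`1 - a ^ 2 / 2`. -/
theorem inner_le_of_inner_nonpos {u v ν : E} {a : ℝ} (hν : ‖ν‖ = 1) (hv : ⟪v, ν⟫ ≤ 0)
    (ha : 0 ≤ a) (ha1 : a ≤ 1) (hu : ⟪u, ν⟫ = a * ‖u‖) :
    ⟪u, v⟫ ≤ (1 - a ^ 2 / 2) * ‖u‖ * ‖v‖ := by
  have hc : 0 ≤ 1 - a ^ 2 / 2 := by nlinarith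
  have hproj : ‖u - (a * ‖u‖) • ν‖ ≤ (1 - a ^ 2 / 2) * ‖u‖ := by
    refine le_of_sq_le_sq ?_ (by positivity)
    rw [norm_sub_sq_real, real_inner_smul_right, hu, norm_smul, hν, mul_one, Real.norm_eq_abs,
      sq_abs]
    nlinarith [sq_nonneg (a ^ 2 * ‖u‖)]
  have hsplit : ⟪u - (a * ‖u‖) • ν, v⟫ = ⟪u, v⟫ - a * ‖u‖ * ⟪v, ν⟫ := by
    rw [inner_sub_left, real_inner_smul_left, real_inner_comm v ν]
  have hcs := real_inner_le_norm (u - (a * ‖u‖) • ν) v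
  have hneg := mul_nonpos_of_nonneg_of_nonpos (mul_nonneg ha (norm_nonneg u)) hv
  have := mul_le_mul_of_nonneg_right hproj (norm_nonneg v)
  linarith

theorem norm_sub_mul_le_norm_sub {u v : E} {c : ℝ} (hc : 0 ≤ c) (hc1 : c ≤ 1)
    (h : ⟪u, v⟫ ≤ c * ‖u‖ * ‖v‖) : ‖u‖ - c * ‖v‖ ≤ ‖u - v‖ := by
  refine le_of_sq_le_sq ?_ (norm_nonneg _)
  rw [norm_sub_sq_real]
  have : c ^ 2 * ‖v‖ ^ 2 ≤ ‖v‖ ^ 2 :=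
    mul_le_of_le_one_left (sq_nonneg _) (pow_le_one₀ hc hc1)
  nlinarith

end HalfSpace

/-- quantitative linear lower bound (Lemma 6.2 (i)). -/
theorem stmt_5 (S : Set (EuclideanSpace ℝ (Fin 3)))
    (x p ν : EuclideanSpace ℝ (Fin 3))
    (hx : x ∈ S) (hpx : p ≠ x) (hν : ‖ν‖ = 1)
    (hsupp : ∀ z ∈ S, ⟪z - x, ν⟫ ≤ 0)
    (hα : 0 < ⟪p - x, ν⟫ / ‖p - x‖) :
    ∀ z ∈ S, ‖p - z‖ + ‖z - x‖ ≥
      ‖p - x‖ + (min ((⟪p - x, ν⟫ / ‖p - x‖) ^ 2) 2 / 2) * ‖z - x‖ := by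
  intro z hz
  have hL : 0 < ‖p - x‖ := norm_pos_iff.2 (sub_ne_zero.2 hpx)
  have hu : ⟪p - x, ν⟫ = ⟪p - x, ν⟫ / ‖p - x‖ * ‖p - x‖ := (div_mul_cancel₀ _ hL.ne').symm
  have ha1 : ⟪p - x, ν⟫ / ‖p - x‖ ≤ 1 := by
    rw [div_le_one hL]
    simpa [hν] using real_inner_le_norm (p - x) ν
  generalize ⟪p - x, ν⟫ / ‖p - x‖ = a at *
  have hinner := inner_le_of_inner_nonpos hν (hsupp z hz) hα.le ha1 hu
  have hnorm := norm_sub_mul_le_norm_sub (by nlinarith) (by nlinarith) hinner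
  rw [sub_sub_sub_cancel_right] at hnorm
  rw [min_eq_left (by nlinarith)]
  linarith
end

section
/- Let p, x, x*, z ∈ ℝ³ with x* ≠ p, x* ≠ x, and suppose ‖p − x‖ = ‖p − x*‖ + ‖x* − x‖ (i.e. x* lies on the segment joining p and x). Put ξ = z − x*. Then ‖p − z‖ + ‖z − x‖ − ‖p − x‖ = (1/(‖p − z‖ + ‖p − x*‖) + 1/(‖z − x‖ + ‖x* − x‖)) · ‖ξ‖² + 2⟨R(z), ξ⟩, where R(z) = (x* − p)/(‖p − z‖ + ‖p − x*‖) + (x* − x)/(‖z − x‖ + ‖x* − x‖). -/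
open scoped RealInnerProductSpace

/-- The increment of the norm along `v`, obtained by rationalizing the difference. -/
theorem norm_add_sub_norm_eq {E : Type*} [NormedAddCommGroup E] [InnerProductSpace ℝ E]
    {a : E} (ha : a ≠ 0) (v : E) :
    ‖a + v‖ - ‖a‖ =
      1 / (‖a + v‖ + ‖a‖) * ‖v‖ ^ 2 + 2 * (1 / (‖a + v‖ + ‖a‖) * inner ℝ a v) := by
  have hpos : 0 < ‖a + v‖ + ‖a‖ := add_pos_of_nonneg_of_pos (norm_nonneg _) (norm_pos_iff.mpr ha)
  have hsq := norm_add_sq_real a v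
  field_simp
  linarith

/-- exact second-order expansion (6.10) of the broken-path length
around the reflection point `xs` on the segment `p x`. -/
theorem stmt_6 (p x xs z : EuclideanSpace ℝ (Fin 3))
    (h1 : xs ≠ p) (h2 : xs ≠ x)
    (hseg : ‖p - x‖ = ‖p - xs‖ + ‖xs - x‖) :
    ‖p - z‖ + ‖z - x‖ - ‖p - x‖ =
      (1 / (‖p - z‖ + ‖p - xs‖) + 1 / (‖z - x‖ + ‖xs - x‖)) * ‖z - xs‖ ^ 2
      + 2 * ⟪(1 / (‖p - z‖ + ‖p - xs‖)) • (xs - p)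
              + (1 / (‖z - x‖ + ‖xs - x‖)) • (xs - x), z - xs⟫ := by
  have hp := norm_add_sub_norm_eq (sub_ne_zero.mpr h1) (z - xs)
  have hx := norm_add_sub_norm_eq (sub_ne_zero.mpr h2) (z - xs)
  rw [sub_add_sub_cancel', norm_sub_rev z p, norm_sub_rev xs p] at hp
  rw [sub_add_sub_cancel'] at hx
  rw [hseg, inner_add_left, real_inner_smul_left, real_inner_smul_left]
  linarith
end

section
/- Let U ⊂ ℝⁿ be a bounded open set, 0 < α ≤ 1, and let f : ℝⁿ → ℝ be twice continuously differentiable on an open set containing closure(U), with second derivative α-Hölder continuous on closure(U). Suppose x₀ ∈ U satisfies f(x) > f(x₀) for all x ∈ closure(U) \ {x₀}, and the Hessian matrix H = Hess f(x₀) is positive definite. Then there exist constants C > 0 and τ₀ > 0 such that for every function φ : ℝⁿ → ℝ that is α-Hölder continuous on closure(U) and every τ ≥ τ₀: | ∫_U e^{−τ f(x)} φ(x) dx − e^{−τ f(x₀)} (2π/τ)^{n/2} (det H)^{−1/2} φ(x₀) | ≤ C ‖φ‖_{C^{0,α}} e^{−τ f(x₀)} τ^{−(n+α)/2}, where ‖φ‖_{C^{0,α}}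 = sup_{closure(U)} |φ| + sup_{x ≠ y ∈ closure(U)} |φ(x) − φ(y)| / ‖x − y‖^α. -/
open scoped Real

open scoped MatrixOrder Matrix in
lemma Matrix.PosDef.exists_linearMap_norm_sq_eq {n : ℕ} {H : Matrix (Fin n) (Fin n) ℝ}
    (hH : H.PosDef) :
    ∃ B : EuclideanSpace ℝ (Fin n) →ₗ[ℝ] EuclideanSpace ℝ (Fin n),
      (∀ x, ‖B x‖ ^ 2 = x.ofLp ⬝ᵥ (H *ᵥ x.ofLp)) ∧
        |LinearMap.det B| = √H.det ∧ LinearMap.det B ≠ 0 := by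
  set S := CFC.sqrt H with hS
  have hSS : S * S = H := CFC.sqrt_mul_sqrt_self H hH.posSemidef.nonneg
  have hSH : Sᵀ = S := (Matrix.nonneg_iff_posSemidef.1 (CFC.sqrt_nonneg H)).1
  have hdet : S.det * S.det = H.det := by rw [← Matrix.det_mul, hSS]
  have habs : |S.det| = √H.det := by rw [← hdet, Real.sqrt_mul_self_eq_abs]
  refine ⟨S.toLpLin 2 2, fun x => ?_, ?_, ?_⟩
  · rw [EuclideanSpace.real_norm_sq_eq, ← hSS, ← Matrix.mulVec_mulVec, Matrix.dotProduct_mulVec,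
      ← Matrix.mulVec_transpose, hSH]
    simp [dotProduct, sq]
  · rw [LinearMap.det_toLpLin, habs]
  · rw [LinearMap.det_toLpLin]
    intro h
    have := hH.det_pos
    simp [h] at hdet
    exact this.ne hdet

lemma integral_comp_linearMap {E : Type*} [NormedAddCommGroup E] [NormedSpace ℝ E]
    [FiniteDimensional ℝ E] [MeasurableSpace E] [BorelSpace E] (μ : MeasureTheory.Measure E)
    [μ.IsAddHaarMeasure] (B : E →ₗ[ℝ] E) (hB : LinearMap.det B ≠ 0) (g : E → ℝ) :
    ∫ x, g (B x) ∂μ = |LinearMap.det B|⁻¹ * ∫ x, g x ∂μ := by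
  have h := MeasureTheory.Measure.map_linearMap_addHaar_eq_smul_addHaar μ hB
  have he : MeasurableEmbedding B :=
    (((LinearMap.equivOfDetNeZero B hB).toContinuousLinearEquiv.toHomeomorph).measurableEmbedding)
  rw [← he.integral_map, h, MeasureTheory.integral_smul_measure, abs_inv,
    ENNReal.toReal_ofReal (by positivity), smul_eq_mul]

lemma integrable_exp_neg_mul_sq_norm {E : Type*} [NormedAddCommGroup E] [InnerProductSpace ℝ E]
    [FiniteDimensional ℝ E] [MeasurableSpace E] [BorelSpace E] {b : ℝ} (hb : 0 < b) :
    MeasureTheory.Integrable fun x : E => Real.exp (-b * ‖x‖ ^ 2) := by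
  by_contra h
  have h1 := MeasureTheory.integral_undef h
  rw [GaussianFourier.integral_rexp_neg_mul_sq_norm hb] at h1
  have : 0 < (π / b) ^ ((Module.finrank ℝ E : ℝ) / 2) := by positivity
  exact this.ne' h1

open Set Metric in
lemma abs_sub_taylor_two_le {E : Type*} [NormedAddCommGroup E] [NormedSpace ℝ E] {f : E → ℝ}
    {x₀ : E} {r L α : ℝ} (hα : 0 ≤ α) (hL0 : 0 ≤ L) (hf : ContDiffOn ℝ 2 f (ball x₀ r))
    (h0 : fderiv ℝ f x₀ = 0)
    (hL : ∀ x ∈ ball x₀ r,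
      ‖fderiv ℝ (fderiv ℝ f) x - fderiv ℝ (fderiv ℝ f) x₀‖ ≤ L * ‖x - x₀‖ ^ α)
    {x : E} (hx : x ∈ ball x₀ r) :
    |f x - f x₀ - fderiv ℝ (fderiv ℝ f) x₀ (x - x₀) (x - x₀) / 2| ≤
      L * ‖x - x₀‖ ^ α * ‖x - x₀‖ ^ 2 := by
  have hr : 0 < r := pos_of_mem_ball hx
  set A := fderiv ℝ (fderiv ℝ f) x₀ with hA
  set ρ := ‖x - x₀‖ with hρ
  have hρr : ρ < r := by simpa [dist_eq_norm] using hx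
  have hsub : closedBall x₀ ρ ⊆ ball x₀ r := closedBall_subset_ball hρr
  have hmem : x₀ ∈ closedBall x₀ ρ := mem_closedBall_self (norm_nonneg _)
  have hxmem : x ∈ closedBall x₀ ρ := by simp [dist_eq_norm, hρ]
  have hle : ∀ y ∈ closedBall x₀ ρ, ‖y - x₀‖ ≤ ρ := fun y hy => by
    simpa [dist_eq_norm] using hy
  have hcd : ∀ y ∈ ball x₀ r, ContDiffAt ℝ 2 f y := fun y hy =>
    hf.contDiffAt (isOpen_ball.mem_nhds hy)
  have hd : ∀ y ∈ ball x₀ r, HasFDerivAt f (fderiv ℝ f y) y := fun y hy =>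
    ((hcd y hy).differentiableAt (by norm_num)).hasFDerivAt
  have hdd : ∀ y ∈ ball x₀ r, HasFDerivAt (fderiv ℝ f) (fderiv ℝ (fderiv ℝ f) y) y := fun y hy =>
    (((hcd y hy).fderiv_right (m := 1) (by norm_num)).differentiableAt (by norm_num)).hasFDerivAt
  have hsymm : ∀ u v, A u v = A v u := fun u v =>
    (hcd x₀ (mem_ball_self hr)).isSymmSndFDerivAt (by simp) u v
  have h1 : ∀ y ∈ closedBall x₀ ρ, ‖fderiv ℝ f y - A (y - x₀)‖ ≤ L * ρ ^ α * ρ := by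
    intro y hy
    have := Convex.norm_image_sub_le_of_norm_hasFDerivWithin_le' (𝕜 := ℝ) (φ := A)
      (fun z hz => (hdd z (hsub hz)).hasFDerivWithinAt)
      (fun z hz => (hL z (hsub hz)).trans (mul_le_mul_of_nonneg_left
        (Real.rpow_le_rpow (norm_nonneg _) (hle z hz) hα) hL0))
      (convex_closedBall x₀ ρ) hmem hy
    rw [h0, sub_zero] at this
    exact this.trans (mul_le_mul_of_nonneg_left (hle y hy) (by positivity))
  have h2 : ∀ y ∈ closedBall x₀ ρ, HasFDerivWithinAt (fun y => f y - A (y - x₀) (y - x₀) / 2)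
      (fderiv ℝ f y - A (y - x₀)) (closedBall x₀ ρ) y := by
    intro y hy
    have hid : HasFDerivAt (fun y => y - x₀) (ContinuousLinearMap.id ℝ E) y :=
      (hasFDerivAt_id y).sub_const x₀
    have hq := ((A.hasFDerivAt.comp y hid).clm_apply hid).mul_const (2⁻¹ : ℝ)
    refine (((hd y (hsub hy)).sub hq).congr_fderiv ?_).hasFDerivWithinAt
    ext v
    have := hsymm v (y - x₀)
    simp only [map_sub, FunLike.coe_sub, Pi.sub_apply] at this
    simp
    linarith
  have h3 := Convex.norm_image_sub_le_of_norm_hasFDerivWithin_le h2 h1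
    (convex_closedBall x₀ ρ) hmem hxmem
  simp only [sub_self, map_zero, zero_div, sub_zero, Real.norm_eq_abs] at h3
  calc _ = |f x - A (x - x₀) (x - x₀) / 2 - f x₀| := by congr 1; ring
    _ ≤ _ := h3
    _ = _ := by ring

lemma abs_exp_neg_sub_exp_neg_le {a b m : ℝ} (ha : m ≤ a) (hb : m ≤ b) :
    |Real.exp (-a) - Real.exp (-b)| ≤ |a - b| * Real.exp (-m) := by
  wlog hab : a ≤ b generalizing a b
  · rw [abs_sub_comm, abs_sub_comm a]
    exact this hb ha (le_of_not_ge hab)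
  have h1 : Real.exp (-b) = Real.exp (-a) * Real.exp (-(b - a)) := by rw [← Real.exp_add]; ring_nf
  have h2 := Real.add_one_le_exp (-(b - a))
  have h3 : Real.exp (-a) ≤ Real.exp (-m) := Real.exp_le_exp.2 (by linarith)
  have h4 : Real.exp (-b) ≤ Real.exp (-a) := Real.exp_le_exp.2 (by linarith)
  rw [abs_of_nonneg (by linarith), abs_of_nonpos (by linarith)]
  have h5 := Real.exp_pos (-a)
  calc _ = Real.exp (-a) * (1 - Real.exp (-(b - a))) := by rw [h1]; ring
    _ ≤ Real.exp (-a) * (b - a) := mul_le_mul_of_nonneg_left (by linarith) h5.le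
    _ ≤ Real.exp (-m) * (b - a) := mul_le_mul_of_nonneg_right h3 (by linarith)
    _ = _ := by ring

/-- A polynomial weight is absorbed by half of the Gaussian decay, uniformly in the scale `τ`. -/
lemma rpow_mul_add_mul_exp_neg_le {α c τ t : ℝ} (hα0 : 0 < α) (hα1 : α ≤ 1) (hc : 0 < c)
    (hτ : 0 < τ) (ht : 0 ≤ t) :
    t ^ α * (1 + τ * t ^ 2) * Real.exp (-(c * τ * t ^ 2)) ≤
      (1 + 4 / c) ^ 2 * τ ^ (-α / 2) * Real.exp (-(c / 2 * τ) * t ^ 2) := by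
  set u := τ * t ^ 2 with hu
  have hu0 : 0 ≤ u := by positivity
  have ht' : t ^ α = τ ^ (-α / 2) * u ^ (α / 2) := by
    rw [hu, Real.mul_rpow hτ.le (by positivity), ← mul_assoc, ← Real.rpow_add hτ,
      ← Real.rpow_natCast, ← Real.rpow_mul ht]
    simp only [neg_div, neg_add_cancel, Real.rpow_zero, one_mul]
    congr 1
    push_cast
    ring
  have hua : u ^ (α / 2) ≤ 1 + u := by
    calc u ^ (α / 2) ≤ (1 + u) ^ (α / 2) := by gcongr; linarith
      _ ≤ (1 + u) ^ (1 : ℝ) := Real.rpow_le_rpow_of_exponent_le (by linarith) (by linarith)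
      _ = _ := Real.rpow_one _
  have hexp : 1 + u ≤ (1 + 4 / c) * Real.exp (c / 4 * u) := by
    have h1 := Real.add_one_le_exp (c / 4 * u)
    calc 1 + u ≤ (1 + 4 / c) * (c / 4 * u + 1) := by
          have : (1 + 4 / c) * (c / 4 * u + 1) = 1 + u + c / 4 * u + 4 / c := by field_simp; ring
          rw [this]
          have : 0 < 4 / c := by positivity
          nlinarith [mul_nonneg hc.le hu0]
      _ ≤ _ := by gcongr
  calc t ^ α * (1 + u) * Real.exp (-(c * τ * t ^ 2))
      = τ ^ (-α / 2) * (u ^ (α / 2) * (1 + u)) * Real.exp (-(c * u)) := by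
        rw [ht', hu]; ring_nf
    _ ≤ τ ^ (-α / 2) * ((1 + 4 / c) * Real.exp (c / 4 * u) *
          ((1 + 4 / c) * Real.exp (c / 4 * u))) * Real.exp (-(c * u)) := by
        gcongr
        exact hua.trans hexp
    _ = (1 + 4 / c) ^ 2 * τ ^ (-α / 2) *
          (Real.exp (c / 4 * u) * Real.exp (c / 4 * u) * Real.exp (-(c * u))) := by ring
    _ = _ := by
        rw [← Real.exp_add, ← Real.exp_add, hu]
        ring_nf

open Set Metric in
/-- A bound by `‖x - x₀‖ ^ α * ‖x - x₀‖ ^ 2` near `x₀` extends to compact sets. -/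
lemma IsCompact.exists_abs_le_rpow_mul_sq {E : Type*} [NormedAddCommGroup E] {S : Set E}
    (hS : IsCompact S) {g : E → ℝ} (hg : ContinuousOn g S) {x₀ : E} {r L α : ℝ} (hr : 0 < r)
    (hL : 0 ≤ L) (hα : 0 ≤ α)
    (hloc : ∀ x ∈ ball x₀ r, |g x| ≤ L * ‖x - x₀‖ ^ α * ‖x - x₀‖ ^ 2) :
    ∃ K, 0 ≤ K ∧ ∀ x ∈ S, |g x| ≤ K * ‖x - x₀‖ ^ α * ‖x - x₀‖ ^ 2 := by
  obtain ⟨G, hG⟩ := hS.exists_bound_of_continuousOn hg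
  refine ⟨L + |G| / (r ^ α * r ^ 2), by positivity, fun x hx => ?_⟩
  rcases lt_or_ge (dist x x₀) r with h | h
  · refine (hloc x h).trans ?_
    gcongr
    exact le_add_of_nonneg_right (by positivity)
  · rw [dist_eq_norm] at h
    calc |g x| ≤ |G| := (hG x hx).trans (le_abs_self G)
      _ = |G| / (r ^ α * r ^ 2) * (r ^ α * r ^ 2) := by field_simp
      _ ≤ (L + |G| / (r ^ α * r ^ 2)) * (‖x - x₀‖ ^ α * ‖x - x₀‖ ^ 2) := by
        gcongr
        exact le_add_of_nonneg_left hL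
      _ = _ := by ring

open Set Metric in
/-- Quadratic growth near a strict minimum extends to compact sets. -/
lemma IsCompact.exists_mul_sq_le_sub {E : Type*} [NormedAddCommGroup E] {S : Set E}
    (hS : IsCompact S) {f : E → ℝ} (hf : ContinuousOn f S) {x₀ : E} {ρ c₀ : ℝ} (hρ : 0 < ρ)
    (hc₀ : 0 < c₀) (hmin : ∀ x ∈ S, x ≠ x₀ → f x₀ < f x)
    (hloc : ∀ x ∈ S, x ∈ ball x₀ ρ → c₀ * ‖x - x₀‖ ^ 2 ≤ f x - f x₀) :
    ∃ c, 0 < c ∧ c ≤ c₀ ∧ ∀ x ∈ S, c * ‖x - x₀‖ ^ 2 ≤ f x - f x₀ := by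
  have hne : ∀ x ∈ S \ ball x₀ ρ, 0 < ‖x - x₀‖ := fun x hx => by
    have : ρ ≤ ‖x - x₀‖ := by simpa [dist_eq_norm] using hx.2
    exact hρ.trans_le this
  have hcont : ContinuousOn (fun x => (f x - f x₀) / ‖x - x₀‖ ^ 2) (S \ ball x₀ ρ) := by
    refine ContinuousOn.div ((hf.mono sdiff_subset).sub continuousOn_const) (by fun_prop) ?_
    exact fun x hx => (pow_pos (hne x hx) 2).ne'
  obtain ⟨d, hd, hdle⟩ := (hS.diff isOpen_ball).exists_forall_le' hcont (a := 0) fun x hx =>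
    div_pos (sub_pos.2 (hmin x hx.1 (sub_ne_zero.1 (norm_pos_iff.1 (hne x hx)))))
      (pow_pos (hne x hx) 2)
  refine ⟨min c₀ d, lt_min hc₀ hd, min_le_left _ _, fun x hx => ?_⟩
  by_cases h : x ∈ ball x₀ ρ
  · exact (mul_le_mul_of_nonneg_right (min_le_left _ _) (by positivity)).trans (hloc x hx h)
  · have := hdle x ⟨hx, h⟩
    rw [le_div_iff₀ (pow_pos (hne x ⟨hx, h⟩) 2)] at this
    exact (mul_le_mul_of_nonneg_right (min_le_right _ _) (by positivity)).trans this

lemma continuousOn_of_abs_sub_le_rpow {E : Type*} [NormedAddCommGroup E] {S : Set E}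
    {φ : E → ℝ} {M α : ℝ} (hα : 0 < α)
    (h : ∀ x ∈ S, ∀ y ∈ S, |φ x - φ y| ≤ M * ‖x - y‖ ^ α) : ContinuousOn φ S := by
  intro y hy
  rw [ContinuousWithinAt, tendsto_iff_norm_sub_tendsto_zero]
  refine squeeze_zero' (.of_forall fun _ => norm_nonneg _)
    (Filter.eventually_of_mem self_mem_nhdsWithin fun x hx => h x hx y hy) ?_
  have : Continuous fun x => M * ‖x - y‖ ^ α :=
    continuous_const.mul ((continuous_id.sub continuous_const).norm.rpow_const
      fun _ => Or.inr hα.le)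
  simpa [Real.zero_rpow hα.ne'] using (this.tendsto y).mono_left nhdsWithin_le_nhds

open Matrix in
lemma ContinuousLinearMap.apply_apply_eq_dotProduct_mulVec {n : ℕ}
    (A : EuclideanSpace ℝ (Fin n) →L[ℝ] EuclideanSpace ℝ (Fin n) →L[ℝ] ℝ)
    {H : Matrix (Fin n) (Fin n) ℝ}
    (hH : ∀ i j, H i j = A (EuclideanSpace.single i 1) (EuclideanSpace.single j 1))
    (u : EuclideanSpace ℝ (Fin n)) : A u u = u.ofLp ⬝ᵥ (H *ᵥ u.ofLp) := by
  have hu : u = ∑ i, u i • EuclideanSpace.single i (1 : ℝ) := by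
    simpa using ((EuclideanSpace.basisFun (Fin n) ℝ).sum_repr u).symm
  conv_lhs => rw [hu]
  simp only [map_sum, map_smul, dotProduct, mulVec, hH, FunLike.coe_sum, Finset.sum_apply,
    FunLike.coe_smul, Pi.smul_apply, smul_eq_mul]
  simp only [Finset.mul_sum]
  rw [Finset.sum_comm]
  exact Finset.sum_congr rfl fun i _ => Finset.sum_congr rfl fun j _ => by ring

lemma integral_exp_neg_mul_norm_sq_sub {n : ℕ} {τ d : ℝ} (hτ : 0 < τ)
    {B : EuclideanSpace ℝ (Fin n) →ₗ[ℝ] EuclideanSpace ℝ (Fin n)} (hB : LinearMap.det B ≠ 0)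
    (hd : |LinearMap.det B| = d) (x₀ : EuclideanSpace ℝ (Fin n)) :
    ∫ x, Real.exp (-(τ * (‖B (x - x₀)‖ ^ 2 / 2))) = (2 * π / τ) ^ ((n : ℝ) / 2) * d⁻¹ := by
  rw [MeasureTheory.integral_sub_right_eq_self
    (fun x => Real.exp (-(τ * (‖B x‖ ^ 2 / 2)))) x₀,
    integral_comp_linearMap _ B hB (fun y => Real.exp (-(τ * (‖y‖ ^ 2 / 2)))), hd, mul_comm]
  congr 1
  have := GaussianFourier.integral_rexp_neg_mul_sq_norm (V := EuclideanSpace ℝ (Fin n))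
    (half_pos hτ)
  rw [finrank_euclideanSpace_fin] at this
  have h : π / (τ / 2) = 2 * π / τ := by field_simp
  rw [← h, ← this]
  ring_nf

lemma norm_fderiv_fderiv_sub_le {E : Type*} [NormedAddCommGroup E] [NormedSpace ℝ E]
    (f : E → ℝ) (x y : E) :
    ‖fderiv ℝ (fderiv ℝ f) x - fderiv ℝ (fderiv ℝ f) y‖ ≤
      ‖iteratedFDeriv ℝ 2 f x - iteratedFDeriv ℝ 2 f y‖ := by
  refine ContinuousLinearMap.opNorm_le_bound₂ _ (norm_nonneg _) fun u v => ?_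
  have := (iteratedFDeriv ℝ 2 f x - iteratedFDeriv ℝ 2 f y).le_opNorm ![u, v]
  simpa [iteratedFDeriv_two_apply, Fin.prod_univ_two, mul_assoc] using this

/-- Pointwise comparison of the Laplace integrand with its Gaussian model. -/
lemma abs_indicator_sub_gaussian_le {E : Type*} [NormedAddCommGroup E] {U : Set E} {f φ q : E → ℝ}
    {x₀ : E} {r c K M α τ : ℝ} (hα : 0 ≤ α) (hr : 0 < r) (hK : 0 ≤ K) (hM : 0 ≤ M) (hτ : 0 < τ)
    (hball : Metric.ball x₀ r ⊆ U)
    (htaylor : ∀ x ∈ U, |f x - f x₀ - q (x - x₀)| ≤ K * ‖x - x₀‖ ^ α * ‖x - x₀‖ ^ 2)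
    (hgrowth : ∀ x ∈ U, c * ‖x - x₀‖ ^ 2 ≤ f x - f x₀) (hq : ∀ h, c * ‖h‖ ^ 2 ≤ q h)
    (hφ₀ : |φ x₀| ≤ M) (hφ : ∀ x ∈ U, |φ x - φ x₀| ≤ M * ‖x - x₀‖ ^ α) (x : E) :
    |U.indicator (fun x => Real.exp (-τ * f x) * φ x) x -
        Real.exp (-τ * f x₀) * φ x₀ * Real.exp (-(τ * q (x - x₀)))| ≤
      Real.exp (-τ * f x₀) * M * (1 + K + (r ^ α)⁻¹) *
        (‖x - x₀‖ ^ α * (1 + τ * ‖x - x₀‖ ^ 2) * Real.exp (-(c * τ * ‖x - x₀‖ ^ 2))) := by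
  set t := ‖x - x₀‖ with ht
  have ht0 : 0 ≤ t := norm_nonneg _
  set m := c * τ * t ^ 2 with hm
  have hqm : m ≤ τ * q (x - x₀) := by
    have := mul_le_mul_of_nonneg_left (hq (x - x₀)) hτ.le
    rw [hm]; linarith
  have hri : 0 ≤ (r ^ α)⁻¹ := by positivity
  have htα : 0 ≤ t ^ α := by positivity
  by_cases hx : x ∈ U
  · rw [Set.indicator_of_mem hx]
    have hfm : m ≤ τ * (f x - f x₀) := by
      have := mul_le_mul_of_nonneg_left (hgrowth x hx) hτ.le
      rw [hm]; linarith
    have h1 : Real.exp (-τ * f x) = Real.exp (-τ * f x₀) * Real.exp (-(τ * (f x - f x₀))) := by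
      rw [← Real.exp_add]; ring_nf
    have h2 : |Real.exp (-(τ * (f x - f x₀))) - Real.exp (-(τ * q (x - x₀)))| ≤
        τ * (K * t ^ α * t ^ 2) * Real.exp (-m) := by
      refine (abs_exp_neg_sub_exp_neg_le hfm hqm).trans ?_
      rw [← mul_sub, abs_mul, abs_of_pos hτ]
      gcongr
      exact htaylor x hx
    have h3 : Real.exp (-(τ * (f x - f x₀))) ≤ Real.exp (-m) := Real.exp_le_exp.2 (by linarith)
    calc _ = Real.exp (-τ * f x₀) * |Real.exp (-(τ * (f x - f x₀))) * (φ x - φ x₀) +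
          (Real.exp (-(τ * (f x - f x₀))) - Real.exp (-(τ * q (x - x₀)))) * φ x₀| := by
          rw [h1, ← abs_of_pos (Real.exp_pos (-τ * f x₀)), ← abs_mul,
            abs_of_pos (Real.exp_pos (-τ * f x₀))]
          ring_nf
      _ ≤ Real.exp (-τ * f x₀) * (Real.exp (-m) * (M * t ^ α) +
          τ * (K * t ^ α * t ^ 2) * Real.exp (-m) * M) := by
          gcongr
          refine (abs_add_le _ _).trans ?_
          rw [abs_mul, abs_mul, Real.abs_exp]
          gcongr
          exact hφ x hx
      _ = Real.exp (-τ * f x₀) * M * (t ^ α * (1 + K * (τ * t ^ 2)) * Real.exp (-m)) := by ring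
      _ ≤ Real.exp (-τ * f x₀) * M *
          (t ^ α * ((1 + K + (r ^ α)⁻¹) * (1 + τ * t ^ 2)) * Real.exp (-m)) := by
          have hu : 0 ≤ τ * t ^ 2 := by positivity
          gcongr
          nlinarith [mul_nonneg hri hu]
      _ = _ := by ring
  · rw [Set.indicator_of_notMem hx, zero_sub, abs_neg, abs_mul, abs_mul, Real.abs_exp,
      Real.abs_exp]
    have hrt : r ≤ t := by
      by_contra! h
      exact hx (hball (by simpa [dist_eq_norm] using h))
    have h1 : 1 ≤ (r ^ α)⁻¹ * t ^ α := by
      rw [inv_mul_eq_div, one_le_div (by positivity)]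
      exact Real.rpow_le_rpow hr.le hrt hα
    have h2 : 1 ≤ (1 + K + (r ^ α)⁻¹) * (t ^ α * (1 + τ * t ^ 2)) := by
      have hu : 0 ≤ τ * t ^ 2 := by positivity
      calc 1 ≤ (r ^ α)⁻¹ * t ^ α * 1 := by linarith
        _ ≤ (1 + K + (r ^ α)⁻¹) * t ^ α * (1 + τ * t ^ 2) := by
          gcongr <;> linarith
        _ = _ := by ring
    calc _ ≤ Real.exp (-τ * f x₀) * M * Real.exp (-m) := by gcongr
      _ = Real.exp (-τ * f x₀) * M * Real.exp (-m) * 1 := (mul_one _).symm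
      _ ≤ Real.exp (-τ * f x₀) * M * Real.exp (-m) *
          ((1 + K + (r ^ α)⁻¹) * (t ^ α * (1 + τ * t ^ 2))) := by gcongr
      _ = _ := by ring

/-- the Laplace method asymptotic formula (Lemma 5.2).  Here `M`
plays the role of (an upper bound for) the Hölder norm `‖φ‖_{C^{0,α}}`. -/
theorem stmt_7 (n : ℕ) (U : Set (EuclideanSpace ℝ (Fin n))) (α : ℝ)
    (hα0 : 0 < α) (hα1 : α ≤ 1)
    (hUo : IsOpen U) (hUb : Bornology.IsBounded U)
    (f : EuclideanSpace ℝ (Fin n) → ℝ)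
    (V : Set (EuclideanSpace ℝ (Fin n))) (hVo : IsOpen V) (hUV : closure U ⊆ V)
    (hf : ContDiffOn ℝ 2 f V)
    (hf2 : ∃ L : ℝ, ∀ x ∈ closure U, ∀ y ∈ closure U,
      ‖iteratedFDeriv ℝ 2 f x - iteratedFDeriv ℝ 2 f y‖ ≤ L * ‖x - y‖ ^ α)
    (x₀ : EuclideanSpace ℝ (Fin n)) (hx₀ : x₀ ∈ U)
    (hmin : ∀ x ∈ closure U, x ≠ x₀ → f x₀ < f x)
    (H : Matrix (Fin n) (Fin n) ℝ)
    (hH : ∀ i j, H i j =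
      iteratedFDeriv ℝ 2 f x₀ ![EuclideanSpace.single i 1, EuclideanSpace.single j 1])
    (hHpd : H.PosDef) :
    ∃ C > (0:ℝ), ∃ τ₀ > (0:ℝ),
      ∀ (φ : EuclideanSpace ℝ (Fin n) → ℝ) (M : ℝ),
        (∀ x ∈ closure U, |φ x| ≤ M) →
        (∀ x ∈ closure U, ∀ y ∈ closure U, |φ x - φ y| ≤ M * ‖x - y‖ ^ α) →
        ∀ τ : ℝ, τ₀ ≤ τ →
          |(∫ x in U, Real.exp (-τ * f x) * φ x) -
              Real.exp (-τ * f x₀) * (2 * π / τ) ^ ((n : ℝ) / 2) *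
                (Real.sqrt H.det)⁻¹ * φ x₀| ≤
            C * M * Real.exp (-τ * f x₀) * τ ^ (-((n : ℝ) + α) / 2) := by
  obtain ⟨L₀, hL₀⟩ := hf2
  have hSc : IsCompact (closure U) := hUb.isCompact_closure
  have hsub : U ⊆ closure U := subset_closure
  obtain ⟨r, hr, hball⟩ := Metric.isOpen_iff.1 hUo x₀ hx₀
  obtain ⟨B, hBq, hBdet, hB0⟩ := hHpd.exists_linearMap_norm_sq_eq
  set A := fderiv ℝ (fderiv ℝ f) x₀ with hA
  have hAB : ∀ h, A h h = ‖B h‖ ^ 2 := fun h => by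
    rw [hBq, A.apply_apply_eq_dotProduct_mulVec fun i j => ?_]
    simp [hH, iteratedFDeriv_two_apply, hA]
  obtain ⟨c₀, hc₀, hq₀⟩ : ∃ c₀ > 0, ∀ h, 2 * c₀ * ‖h‖ ^ 2 ≤ ‖B h‖ ^ 2 / 2 := by
    obtain ⟨k, hk, hBk⟩ := B.exists_antilipschitzWith
      (LinearMap.ker_eq_bot.2 (LinearMap.equivOfDetNeZero B hB0).injective)
    have hk' : (0 : ℝ) < k := hk
    refine ⟨1 / (4 * k ^ 2), by positivity, fun h => ?_⟩
    have h1 : ‖h‖ ≤ k * ‖B h‖ := by simpa [dist_eq_norm] using hBk.le_mul_dist h 0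
    have h2 : ‖h‖ ^ 2 ≤ k ^ 2 * ‖B h‖ ^ 2 := by
      rw [← mul_pow]; gcongr
    calc 2 * (1 / (4 * (k : ℝ) ^ 2)) * ‖h‖ ^ 2
        ≤ 2 * (1 / (4 * (k : ℝ) ^ 2)) * (k ^ 2 * ‖B h‖ ^ 2) := by gcongr
      _ = _ := by field_simp; ring
  have hgrad : fderiv ℝ f x₀ = 0 := by
    refine IsLocalMin.fderiv_eq_zero ?_
    filter_upwards [hUo.mem_nhds hx₀] with x hx
    rcases eq_or_ne x x₀ with rfl | h
    · exact le_rfl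
    · exact (hmin x (hsub hx) h).le
  have hfc : ContinuousOn f (closure U) := hf.continuousOn.mono hUV
  obtain ⟨K, hK, hKT⟩ := hSc.exists_abs_le_rpow_mul_sq (x₀ := x₀) (r := r) (L := |L₀|) (α := α)
    (g := fun x => f x - f x₀ - ‖B (x - x₀)‖ ^ 2 / 2)
    (by
      have : Continuous B := B.continuous_of_finiteDimensional
      exact (hfc.sub continuousOn_const).sub (by fun_prop : Continuous _).continuousOn)
    hr (abs_nonneg _) hα0.le fun x hx => by
      rw [← hAB]
      refine abs_sub_taylor_two_le hα0.le (abs_nonneg _)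
        (hf.mono ((hball.trans hsub).trans hUV)) hgrad (fun y hy => ?_) hx
      refine (norm_fderiv_fderiv_sub_le f y x₀).trans
        ((hL₀ y (hsub (hball hy)) x₀ (hsub hx₀)).trans ?_)
      gcongr
      exact le_abs_self _
  obtain ⟨c, hc, hcc₀, hgrowth⟩ := hSc.exists_mul_sq_le_sub hfc (x₀ := x₀)
    (ρ := (c₀ / (K + 1)) ^ α⁻¹) (by positivity) hc₀ hmin fun x hx hxρ => by
      rw [mem_ball_iff_norm] at hxρ
      have h1 : ‖x - x₀‖ ^ α ≤ c₀ / (K + 1) := by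
        calc ‖x - x₀‖ ^ α ≤ ((c₀ / (K + 1)) ^ α⁻¹) ^ α := by gcongr
          _ = _ := Real.rpow_inv_rpow (by positivity) hα0.ne'
      have h2 : K * ‖x - x₀‖ ^ α ≤ c₀ := by
        rw [le_div_iff₀ (by positivity)] at h1
        nlinarith [Real.rpow_nonneg (norm_nonneg (x - x₀)) α]
      have h3 := (abs_le.1 (hKT x hx)).1
      have h4 := mul_le_mul_of_nonneg_right h2 (sq_nonneg ‖x - x₀‖)
      have h5 := hq₀ (x - x₀)
      linarith
  have hq : ∀ h, c * ‖h‖ ^ 2 ≤ ‖B h‖ ^ 2 / 2 := fun h =>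
    (mul_le_mul_of_nonneg_right (by linarith) (sq_nonneg ‖h‖)).trans (hq₀ h)
  refine ⟨(1 + K + (r ^ α)⁻¹) * (1 + 4 / c) ^ 2 * (2 * π / c) ^ ((n : ℝ) / 2), by positivity,
    1, one_pos, fun φ M hφM hφH τ hτ1 => ?_⟩
  have hτ : 0 < τ := one_pos.trans_le hτ1
  have hφ₀ := hφM x₀ (hsub hx₀)
  have hM : 0 ≤ M := (abs_nonneg _).trans hφ₀
  have hdet : 0 < √H.det := Real.sqrt_pos.2 hHpd.det_pos
  have hgauss := integral_exp_neg_mul_norm_sq_sub hτ hB0 hBdet x₀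
  have hgint : MeasureTheory.Integrable
      fun x => Real.exp (-(τ * (‖B (x - x₀)‖ ^ 2 / 2))) := by
    by_contra h
    rw [MeasureTheory.integral_undef h] at hgauss
    have : 0 < (2 * π / τ) ^ ((n : ℝ) / 2) * (√H.det)⁻¹ := by positivity
    exact this.ne hgauss
  have hUint : MeasureTheory.IntegrableOn (fun x => Real.exp (-τ * f x) * φ x) U :=
    (((continuousOn_const.mul hfc).rexp.mul
      (continuousOn_of_abs_sub_le_rpow hα0 hφH)).integrableOn_compact hSc).mono_set hsub
  have hbound : ∀ x, ‖U.indicator (fun x => Real.exp (-τ * f x) * φ x) x -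
        Real.exp (-τ * f x₀) * φ x₀ * Real.exp (-(τ * (‖B (x - x₀)‖ ^ 2 / 2)))‖ ≤
      Real.exp (-τ * f x₀) * M * (1 + K + (r ^ α)⁻¹) * ((1 + 4 / c) ^ 2 * τ ^ (-α / 2)) *
        Real.exp (-(c / 2 * τ) * ‖x - x₀‖ ^ 2) := fun x => by
    refine (abs_indicator_sub_gaussian_le (q := fun h => ‖B h‖ ^ 2 / 2) hα0.le hr hK hM hτ hball
      (fun x hx => hKT x (hsub hx)) (fun x hx => hgrowth x (hsub hx)) hq hφ₀
      (fun x hx => hφH x (hsub hx) x₀ (hsub hx₀)) x).trans ?_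
    rw [mul_assoc _ ((1 + 4 / c) ^ 2 * τ ^ (-α / 2))]
    exact mul_le_mul_of_nonneg_left
      (rpow_mul_add_mul_exp_neg_le hα0 hα1 hc hτ (norm_nonneg (x - x₀))) (by positivity)
  have hcτ : 0 < c / 2 * τ := by positivity
  have hint := MeasureTheory.norm_integral_le_of_norm_le
    (((integrable_exp_neg_mul_sq_norm (E := EuclideanSpace ℝ (Fin n)) hcτ).comp_sub_right
      x₀).const_mul _) (.of_forall hbound)
  rw [MeasureTheory.integral_sub (hUint.integrable_indicator hUo.measurableSet)
      (hgint.const_mul _), MeasureTheory.integral_indicator hUo.measurableSet,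
    MeasureTheory.integral_const_mul, MeasureTheory.integral_const_mul, hgauss,
    MeasureTheory.integral_sub_right_eq_self
      (fun x : EuclideanSpace ℝ (Fin n) => Real.exp (-(c / 2 * τ) * ‖x‖ ^ 2)) x₀,
    GaussianFourier.integral_rexp_neg_mul_sq_norm hcτ, finrank_euclideanSpace_fin,
    Real.norm_eq_abs] at hint
  have hpow : τ ^ (-α / 2) * (π / (c / 2 * τ)) ^ ((n : ℝ) / 2) =
      (2 * π / c) ^ ((n : ℝ) / 2) * τ ^ (-((n : ℝ) + α) / 2) := by
    have h1 : π / (c / 2 * τ) = 2 * π / c * τ⁻¹ := by field_simp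
    rw [h1, Real.mul_rpow (by positivity) (by positivity), Real.inv_rpow hτ.le,
      ← Real.rpow_neg hτ.le, mul_left_comm, ← Real.rpow_add hτ]
    ring_nf
  calc _ = _ := by congr 1; ring
    _ ≤ _ := hint
    _ = Real.exp (-τ * f x₀) * M * (1 + K + (r ^ α)⁻¹) * (1 + 4 / c) ^ 2 *
        (τ ^ (-α / 2) * (π / (c / 2 * τ)) ^ ((n : ℝ) / 2)) := by ring
    _ = _ := by rw [hpow]; ring
end

section
/- Let U ⊂ ℝⁿ be a bounded open set, 0 < α ≤ 1, and let f : ℝⁿ → ℝ be twice continuously differentiable on an open set containing closure(U), with second derivative α-Hölder continuous on closure(U). Suppose x₀ ∈ U satisfies f(x) > f(x₀) for all x ∈ closure(U) \ {x₀}, and Hess f(x₀) is positive definite. Then there exists a constant C > 0 such that for every continuous bounded φ : closure(U) → ℝ and every τ ≥ 1: | ∫_U e^{−τ f(x)} φ(x) dx | ≤ C e^{−τ f(x₀)} τ^{−n/2} · sup_{closure(U)} |φ|. -/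
open Filter Topology MeasureTheory
open scoped Matrix

/-- A coercive second derivative at a critical point forces quadratic growth nearby. -/
theorem eventually_quadratic_growth_of_coercive_hessian {E : Type*} [NormedAddCommGroup E]
    [NormedSpace ℝ E] {f : E → ℝ} {x₀ : E} {c : ℝ} (hc : 0 < c) (hf : ContDiffAt ℝ 2 f x₀)
    (hcrit : fderiv ℝ f x₀ = 0) (hB : ∀ h, c * ‖h‖ ^ 2 ≤ fderiv ℝ (fderiv ℝ f) x₀ h h) :
    ∀ᶠ x in 𝓝 x₀, f x₀ + c / 4 * ‖x - x₀‖ ^ 2 ≤ f x := by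
  have hF : HasFDerivAt (fderiv ℝ f) (fderiv ℝ (fderiv ℝ f) x₀) x₀ :=
    ((hf.fderiv_right (m := 1) (by norm_num)).differentiableAt (by norm_num)).hasFDerivAt
  have hsmall := hF.isLittleO.def (half_pos hc)
  have hdiff : ∀ᶠ y in 𝓝 x₀, DifferentiableAt ℝ f y :=
    (hf.eventually (by simp)).mono fun y hy => hy.differentiableAt (by norm_num)
  obtain ⟨δ, hδ, hball⟩ := Metric.eventually_nhds_iff_ball.1 (hsmall.and hdiff)
  filter_upwards [Metric.ball_mem_nhds x₀ hδ] with x hx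
  set h := x - x₀ with hh
  have hmem : ∀ t ∈ Set.Icc (0 : ℝ) 1, x₀ + t • h ∈ Metric.ball x₀ δ := by
    intro t ht
    rw [mem_ball_iff_norm] at hx ⊢
    rw [add_sub_cancel_left, norm_smul, Real.norm_of_nonneg ht.1]
    exact (mul_le_of_le_one_left (norm_nonneg _) ht.2).trans_lt hx
  have hg : ∀ t ∈ Set.Icc (0 : ℝ) 1,
      HasDerivAt (fun t : ℝ => f (x₀ + t • h) - c / 4 * ‖h‖ ^ 2 * t ^ 2)
        (fderiv ℝ f (x₀ + t • h) h - c / 2 * ‖h‖ ^ 2 * t) t := by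
    intro t ht
    have hline : HasDerivAt (fun t : ℝ => x₀ + t • h) h t := by
      simpa using ((hasDerivAt_id t).smul_const h).const_add x₀
    have hsq := (hasDerivAt_pow 2 t).const_mul (c / 4 * ‖h‖ ^ 2)
    have hcomp := (hball _ (hmem t ht)).2.hasFDerivAt.comp_hasDerivAt t hline
    refine (hcomp.sub hsq).congr_deriv ?_
    push_cast
    ring
  have hmono : MonotoneOn (fun t : ℝ => f (x₀ + t • h) - c / 4 * ‖h‖ ^ 2 * t ^ 2)
      (Set.Icc 0 1) := by
    refine monotoneOn_of_deriv_nonneg (convex_Icc 0 1)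
      (fun t ht => (hg t ht).continuousAt.continuousWithinAt)
      (fun t ht => (hg t (interior_subset ht)).differentiableAt.differentiableWithinAt) ?_
    intro t ht
    have ht' := interior_subset ht
    rw [(hg t ht').deriv]
    have hle := (hball _ (hmem t ht')).1
    rw [hcrit, sub_zero, add_sub_cancel_left, norm_smul, Real.norm_of_nonneg ht'.1] at hle
    have hop := (ContinuousLinearMap.le_opNorm _ h).trans
      (mul_le_mul_of_nonneg_right hle (norm_nonneg h))
    have hlow := (abs_le.1 hop).1
    simp only [map_smul, sub_apply, smul_apply, smul_eq_mul] at hlow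
    nlinarith [mul_le_mul_of_nonneg_left (hB h) ht'.1]
  have hend := hmono (Set.left_mem_Icc.2 zero_le_one) (Set.right_mem_Icc.2 zero_le_one)
    zero_le_one
  simp only [zero_smul, add_zero, one_smul, hh, add_sub_cancel] at hend
  rw [hh]
  linarith

/-- A continuous bilinear form that is positive on the diagonal of a finite-dimensional space is
coercive. -/
theorem exists_coercive_of_pos {E : Type*} [NormedAddCommGroup E] [NormedSpace ℝ E]
    [FiniteDimensional ℝ E] (B : E →L[ℝ] E →L[ℝ] ℝ) (hB : ∀ h, h ≠ 0 → 0 < B h h) :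
    ∃ c > 0, ∀ h, c * ‖h‖ ^ 2 ≤ B h h := by
  have : ProperSpace E := FiniteDimensional.proper_real E
  obtain ⟨c, hc, hle⟩ := (isCompact_sphere (0 : E) 1).exists_forall_le' (f := fun h => B h h)
    (a := 0) (by fun_prop) fun h hh => hB h (ne_zero_of_mem_unit_sphere ⟨h, hh⟩)
  refine ⟨c, hc, fun h => ?_⟩
  rcases eq_or_ne h 0 with rfl | hne
  · simp
  have hpos : 0 < ‖h‖ := norm_pos_iff.2 hne
  have := hle (‖h‖⁻¹ • h) (by simp [norm_smul, hpos.ne'])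
  simp only [map_smul, smul_apply, smul_eq_mul] at this
  calc c * ‖h‖ ^ 2 ≤ (‖h‖⁻¹ * (‖h‖⁻¹ * B h h)) * ‖h‖ ^ 2 := by gcongr
    _ = B h h := by field_simp

/-- Quadratic growth near a strict minimum point propagates to a compact set. -/
theorem exists_quadratic_growth_of_isCompact {E : Type*} [NormedAddCommGroup E] {f : E → ℝ}
    {K : Set E} (hK : IsCompact K) (hf : ContinuousOn f K) {x₀ : E}
    (hmin : ∀ x ∈ K, x ≠ x₀ → f x₀ < f x) {c : ℝ} (hc : 0 < c)
    (hloc : ∀ᶠ x in 𝓝 x₀, f x₀ + c * ‖x - x₀‖ ^ 2 ≤ f x) :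
    ∃ b > 0, ∀ x ∈ K, f x₀ + b * ‖x - x₀‖ ^ 2 ≤ f x := by
  obtain ⟨δ, hδ, hball⟩ := Metric.eventually_nhds_iff_ball.1 hloc
  have hne : ∀ x ∈ K \ Metric.ball x₀ δ, x ≠ x₀ := by
    rintro x hx rfl
    exact hx.2 (Metric.mem_ball_self hδ)
  have hsq : ∀ x ∈ K \ Metric.ball x₀ δ, 0 < ‖x - x₀‖ ^ 2 := fun x hx =>
    pow_pos (norm_pos_iff.2 (sub_ne_zero.2 (hne x hx))) 2
  obtain ⟨m, hm, hle⟩ := (hK.diff Metric.isOpen_ball).exists_forall_le'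
    (f := fun x => (f x - f x₀) / ‖x - x₀‖ ^ 2) (a := 0)
    (((hf.mono Set.sdiff_subset).sub continuousOn_const).div (by fun_prop)
      fun x hx => (hsq x hx).ne')
    fun x hx => div_pos (sub_pos.2 (hmin x hx.1 (hne x hx))) (hsq x hx)
  refine ⟨min c m, lt_min hc hm, fun x hx => ?_⟩
  by_cases hxb : x ∈ Metric.ball x₀ δ
  · refine le_trans ?_ (hball x hxb)
    gcongr
    exact min_le_left c m
  · have hlow := (le_div_iff₀ (hsq x ⟨hx, hxb⟩)).1 (hle x ⟨hx, hxb⟩)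
    have : min c m * ‖x - x₀‖ ^ 2 ≤ m * ‖x - x₀‖ ^ 2 := by
      gcongr
      exact min_le_right c m
    linarith

theorem integrable_rexp_neg_mul_sq_norm {V : Type*} [NormedAddCommGroup V]
    [InnerProductSpace ℝ V] [FiniteDimensional ℝ V] [MeasurableSpace V] [BorelSpace V] {b : ℝ}
    (hb : 0 < b) : Integrable fun v : V => Real.exp (-b * ‖v‖ ^ 2) := by
  by_contra hint
  have h := GaussianFourier.integral_rexp_neg_mul_sq_norm (V := V) hb
  rw [integral_undef hint] at h
  have : 0 < (Real.pi / b) ^ (Module.finrank ℝ V / 2 : ℝ) := by positivity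
  exact this.ne h

/-- Quadratic growth of `f` on `U` bounds the Laplace integral by a Gaussian one. -/
theorem abs_setIntegral_exp_neg_mul_le {n : ℕ} {U : Set (EuclideanSpace ℝ (Fin n))}
    (hU : MeasurableSet U) {f φ : EuclideanSpace ℝ (Fin n) → ℝ} {x₀ : EuclideanSpace ℝ (Fin n)}
    {b M τ : ℝ} (hb : 0 < b) (hM : 0 ≤ M) (hτ : 0 < τ)
    (hf : ∀ x ∈ U, f x₀ + b * ‖x - x₀‖ ^ 2 ≤ f x) (hφ : ∀ x ∈ U, |φ x| ≤ M) :
    |∫ x in U, Real.exp (-τ * f x) * φ x| ≤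
      (Real.pi / b) ^ ((n : ℝ) / 2) * Real.exp (-τ * f x₀) * τ ^ (-(n : ℝ) / 2) * M := by
  have hbτ : 0 < b * τ := mul_pos hb hτ
  have hint : Integrable fun x : EuclideanSpace ℝ (Fin n) =>
      Real.exp (-τ * f x₀) * M * Real.exp (-(b * τ) * ‖x - x₀‖ ^ 2) :=
    ((integrable_rexp_neg_mul_sq_norm hbτ).comp_sub_right x₀).const_mul _
  have hbound : ∀ x ∈ U, ‖Real.exp (-τ * f x) * φ x‖ ≤
      Real.exp (-τ * f x₀) * M * Real.exp (-(b * τ) * ‖x - x₀‖ ^ 2) := by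
    intro x hx
    rw [norm_mul, Real.norm_of_nonneg (Real.exp_nonneg _), mul_right_comm, ← Real.exp_add]
    refine mul_le_mul (Real.exp_le_exp.2 ?_) (hφ x hx) (norm_nonneg _) (Real.exp_nonneg _)
    nlinarith [mul_le_mul_of_nonneg_left (hf x hx) hτ.le]
  calc |∫ x in U, Real.exp (-τ * f x) * φ x|
      ≤ ∫ x in U, Real.exp (-τ * f x₀) * M * Real.exp (-(b * τ) * ‖x - x₀‖ ^ 2) :=
        norm_integral_le_of_norm_le hint.integrableOn
          ((ae_restrict_iff' hU).2 (ae_of_all _ hbound))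
    _ ≤ ∫ x, Real.exp (-τ * f x₀) * M * Real.exp (-(b * τ) * ‖x - x₀‖ ^ 2) :=
        setIntegral_le_integral hint (ae_of_all _ fun x => by positivity)
    _ = Real.exp (-τ * f x₀) * M * (Real.pi / (b * τ)) ^ ((n : ℝ) / 2) := by
        rw [integral_const_mul,
          integral_sub_right_eq_self (fun x : EuclideanSpace ℝ (Fin n) =>
            Real.exp (-(b * τ) * ‖x‖ ^ 2)) x₀,
          GaussianFourier.integral_rexp_neg_mul_sq_norm hbτ, finrank_euclideanSpace_fin]
    _ = _ := by
        rw [← div_div, Real.div_rpow (by positivity) hτ.le, neg_div, Real.rpow_neg hτ.le]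
        ring

/-- A bilinear form on Euclidean space with positive definite Gram matrix is positive on the
diagonal. -/
theorem pos_of_posDef_gram {n : ℕ}
    (B : EuclideanSpace ℝ (Fin n) →L[ℝ] EuclideanSpace ℝ (Fin n) →L[ℝ] ℝ)
    {H : Matrix (Fin n) (Fin n) ℝ}
    (hH : ∀ i j, H i j = B (EuclideanSpace.single i 1) (EuclideanSpace.single j 1))
    (hHpd : H.PosDef) (h : EuclideanSpace ℝ (Fin n)) (hne : h ≠ 0) : 0 < B h h := by
  have hpos := hHpd.dotProduct_mulVec_pos (x := h.ofLp) (by simpa using hne)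
  have hsum : h = ∑ i, h i • EuclideanSpace.single i (1 : ℝ) := by
    simpa using ((EuclideanSpace.basisFun (Fin n) ℝ).sum_repr h).symm
  suffices B h h = star h.ofLp ⬝ᵥ (H.mulVec h.ofLp) by rwa [this]
  conv_lhs => rw [hsum]
  simp only [map_sum, map_smul, sum_apply, smul_apply,
    smul_eq_mul, dotProduct, Matrix.mulVec, hH, star_trivial, Finset.mul_sum]
  rw [Finset.sum_comm]
  refine Finset.sum_congr rfl fun i _ => Finset.sum_congr rfl fun j _ => ?_
  ring

/-- uniform bound part of the Laplace method (Lemma 5.2). -/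
theorem stmt_8 (n : ℕ) (U : Set (EuclideanSpace ℝ (Fin n))) (α : ℝ)
    (hα0 : 0 < α) (hα1 : α ≤ 1)
    (hUo : IsOpen U) (hUb : Bornology.IsBounded U)
    (f : EuclideanSpace ℝ (Fin n) → ℝ)
    (V : Set (EuclideanSpace ℝ (Fin n))) (hVo : IsOpen V) (hUV : closure U ⊆ V)
    (hf : ContDiffOn ℝ 2 f V)
    (hf2 : ∃ L : ℝ, ∀ x ∈ closure U, ∀ y ∈ closure U,
      ‖iteratedFDeriv ℝ 2 f x - iteratedFDeriv ℝ 2 f y‖ ≤ L * ‖x - y‖ ^ α)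
    (x₀ : EuclideanSpace ℝ (Fin n)) (hx₀ : x₀ ∈ U)
    (hmin : ∀ x ∈ closure U, x ≠ x₀ → f x₀ < f x)
    (H : Matrix (Fin n) (Fin n) ℝ)
    (hH : ∀ i j, H i j =
      iteratedFDeriv ℝ 2 f x₀ ![EuclideanSpace.single i 1, EuclideanSpace.single j 1])
    (hHpd : H.PosDef) :
    ∃ C > (0:ℝ),
      ∀ (φ : EuclideanSpace ℝ (Fin n) → ℝ) (M : ℝ),
        ContinuousOn φ (closure U) →
        (∀ x ∈ closure U, |φ x| ≤ M) →
        ∀ τ : ℝ, 1 ≤ τ →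
          |∫ x in U, Real.exp (-τ * f x) * φ x| ≤
            C * Real.exp (-τ * f x₀) * τ ^ (-(n : ℝ) / 2) * M := by
  have hcont : ContDiffAt ℝ 2 f x₀ := hf.contDiffAt (hVo.mem_nhds (hUV (subset_closure hx₀)))
  have hcrit : fderiv ℝ f x₀ = 0 := by
    refine IsLocalMin.fderiv_eq_zero ?_
    filter_upwards [hUo.mem_nhds hx₀] with x hx
    rcases eq_or_ne x x₀ with rfl | hne
    · exact le_rfl
    · exact (hmin x (subset_closure hx) hne).le
  obtain ⟨c, hc, hcoer⟩ := exists_coercive_of_pos (fderiv ℝ (fderiv ℝ f) x₀)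
    (pos_of_posDef_gram _ (fun i j => by simpa [iteratedFDeriv_two_apply] using hH i j) hHpd)
  obtain ⟨b, hb, hgrowth⟩ := exists_quadratic_growth_of_isCompact hUb.isCompact_closure
    (hf.continuousOn.mono hUV) hmin (by positivity)
    (eventually_quadratic_growth_of_coercive_hessian hc hcont hcrit hcoer)
  refine ⟨(Real.pi / b) ^ ((n : ℝ) / 2), by positivity, fun φ M _ hφ τ hτ => ?_⟩
  exact abs_setIntegral_exp_neg_mul_le hUo.measurableSet hb
    ((abs_nonneg _).trans (hφ x₀ (subset_closure hx₀))) (by positivity)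
    (fun x hx => hgrowth x (subset_closure hx)) fun x hx => hφ x (subset_closure hx)
end

section
/- Let Ω ⊂ ℝ³ be a bounded open set, D ⊂ ℝ³ a nonempty open set with closure(D) ⊆ Ω, and p ∈ ℝ³ \ closure(Ω). Then l(p, D) ≤ 2·dist(p, ∂D) − dist(p, ∂Ω). -/
/-- `l(p, D) ≤ 2 dist(p, ∂D) − dist(p, ∂Ω)`. -/
theorem stmt_11
    (Ω D : Set (EuclideanSpace ℝ (Fin 3))) (p : EuclideanSpace ℝ (Fin 3))
    (hΩo : IsOpen Ω) (hΩb : Bornology.IsBounded Ω)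
    (hDo : IsOpen D) (hDne : D.Nonempty) (hDΩ : closure D ⊆ Ω)
    (hp : p ∉ closure Ω) :
    sInf {l : ℝ | ∃ x ∈ frontier D, ∃ y ∈ frontier Ω, l = ‖p - x‖ + ‖x - y‖} ≤
      2 * Metric.infDist p (frontier D) - Metric.infDist p (frontier Ω) := by
  have hDΩ' : frontier D ⊆ Ω := frontier_subset_closure.trans hDΩ
  have hne : (frontier D).Nonempty := by
    rw [nonempty_frontier_iff]
    exact ⟨hDne, fun h => hp (subset_closure (hDΩ (subset_closure (h ▸ Set.mem_univ p))))⟩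
  obtain ⟨x, hx, hpx⟩ := isClosed_frontier.exists_infDist_eq_dist hne p
  obtain ⟨y, hy, hyΩ⟩ : (segment ℝ p x ∩ frontier Ω).Nonempty := by
    by_contra hempty
    obtain ⟨z, -, hzΩ, hz⟩ := (convex_segment p x).isPreconnected Ω (closure Ω)ᶜ hΩo
      isClosed_closure.isOpen_compl
      (fun z hz => by
        by_contra h
        simp only [Set.mem_union, Set.mem_compl_iff, not_or, not_not] at h
        exact hempty ⟨z, hz, hΩo.frontier_eq ▸ ⟨h.2, h.1⟩⟩)
      ⟨x, right_mem_segment ℝ p x, hDΩ' hx⟩ ⟨p, left_mem_segment ℝ p x, hp⟩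
    exact hz (subset_closure hzΩ)
  have hadd := dist_add_dist_of_mem_segment hy
  have hdist := Metric.infDist_le_dist_of_mem (x := p) hyΩ
  have hle : sInf {l : ℝ | ∃ x ∈ frontier D, ∃ y ∈ frontier Ω, l = ‖p - x‖ + ‖x - y‖} ≤
      ‖p - x‖ + ‖x - y‖ := by
    refine csInf_le ⟨0, ?_⟩ ⟨x, hx, y, hyΩ, rfl⟩
    rintro _ ⟨x, -, y, -, rfl⟩
    positivity
  rw [← dist_eq_norm, ← dist_eq_norm, dist_comm x y] at hle
  linarith
end

section
/- Let R > 0, η > 0, and let Ω ⊂ ℝ³ be the open ball of radius R centered at the origin. Let D be an open set with closedBall(0, R/2 + η) ⊆ D and closure(D) ⊆ Ω (in particular R/2 + η < R). Let p ∈ ℝ³ \ closure(Ω) with dist(p, ∂Ω) < 2η. Then l(p, D) < R. -/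
theorem IsPreconnected.inter_frontier_nonempty_of_isOpen {α : Type*} [TopologicalSpace α]
    {s u : Set α} (hs : IsPreconnected s) (hu : IsOpen u) (hsu : (s ∩ u).Nonempty)
    (hsu' : (s ∩ uᶜ).Nonempty) : (s ∩ frontier u).Nonempty := by
  by_contra h
  obtain ⟨y, hys, hyu⟩ := hsu'
  refine hyu (hs.subset_of_closure_inter_subset hu hsu (fun z hz => ?_) hys)
  by_contra hzu
  exact h ⟨z, hz.2, hu.frontier_eq ▸ ⟨hz.1, hzu⟩⟩

/-- the geometric content of Corollary 2.2: if `Ω` is the ball of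
radius `R`, `D` contains the closed ball of radius `R/2 + η`, and
`dist(p, ∂Ω) < 2η`, then `l(p, D) < R`. -/
theorem stmt_12 (R η : ℝ) (hR : 0 < R) (hη : 0 < η)
    (D : Set (EuclideanSpace ℝ (Fin 3))) (hDo : IsOpen D)
    (hball : Metric.closedBall (0 : EuclideanSpace ℝ (Fin 3)) (R / 2 + η) ⊆ D)
    (hDΩ : closure D ⊆ Metric.ball (0 : EuclideanSpace ℝ (Fin 3)) R)
    (p : EuclideanSpace ℝ (Fin 3))
    (hp : p ∉ closure (Metric.ball (0 : EuclideanSpace ℝ (Fin 3)) R))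
    (hdist : Metric.infDist p
      (frontier (Metric.ball (0 : EuclideanSpace ℝ (Fin 3)) R)) < 2 * η) :
    sInf {l : ℝ | ∃ x ∈ frontier D,
      ∃ y ∈ frontier (Metric.ball (0 : EuclideanSpace ℝ (Fin 3)) R),
        l = ‖p - x‖ + ‖x - y‖} < R := by
  have hR0 : R ≠ 0 := hR.ne'
  rw [frontier_ball _ hR0] at hdist ⊢
  rw [closure_ball _ hR0, mem_closedBall_zero_iff, not_le] at hp
  have hp0 : 0 < ‖p‖ := hR.trans hp
  have hne : (Metric.sphere (0 : EuclideanSpace ℝ (Fin 3)) R).Nonempty :=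
    NormedSpace.sphere_nonempty.mpr hR.le
  obtain ⟨z, hz, hpz⟩ := (Metric.infDist_lt_iff hne).1 hdist
  have hpR : ‖p‖ < R + 2 * η := by
    rw [mem_sphere_zero_iff_norm] at hz
    have := norm_sub_norm_le p z
    rw [dist_eq_norm] at hpz
    linarith
  set u : EuclideanSpace ℝ (Fin 3) := ‖p‖⁻¹ • p with hu
  have hu1 : ‖u‖ = 1 := norm_smul_inv_norm (𝕜 := ℝ) (norm_pos_iff.1 hp0)
  have hpu : p = ‖p‖ • u := (smul_inv_smul₀ hp0.ne' p).symm
  have hnorm (t : ℝ) : ‖t • u‖ = |t| := by rw [norm_smul, hu1, mul_one, Real.norm_eq_abs]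
  have hsub (s t : ℝ) : ‖s • u - t • u‖ = |s - t| := by rw [← sub_smul, hnorm]
  have hin : (R / 2 + η) • u ∈ D := hball <| by
    rw [mem_closedBall_zero_iff, hnorm, abs_of_pos (by positivity)]
  have hout : R • u ∉ D := fun h => by
    have := hDΩ (subset_closure h)
    rw [mem_ball_zero_iff, hnorm, abs_of_pos hR] at this
    exact this.false
  have hlt : R / 2 + η < R := by
    have := hDΩ (subset_closure hin)
    rwa [mem_ball_zero_iff, hnorm, abs_of_pos (by positivity)] at this
  have hseg : IsPreconnected ((fun t : ℝ => t • u) '' Set.Icc (R / 2 + η) R) :=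
    isPreconnected_Icc.image _ (by fun_prop)
  obtain ⟨x, ⟨t, ht, rfl⟩, hx⟩ := hseg.inter_frontier_nonempty_of_isOpen hDo
    ⟨_, ⟨_, Set.left_mem_Icc.2 hlt.le, rfl⟩, hin⟩
    ⟨_, ⟨_, Set.right_mem_Icc.2 hlt.le, rfl⟩, hout⟩
  refine csInf_lt_of_lt ⟨0, ?_⟩ ⟨t • u, hx, R • u, ?_, rfl⟩ ?_
  · rintro l ⟨x, -, y, -, rfl⟩
    positivity
  · rw [mem_sphere_zero_iff_norm, hnorm, abs_of_pos hR]
  · have hpt : ‖p - t • u‖ = ‖p‖ - t := by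
      conv_lhs => rw [hpu]
      rw [hsub, abs_of_nonneg (by linarith [ht.2])]
    rw [hpt, hsub, abs_sub_comm, abs_of_nonneg (by linarith [ht.2])]
    linarith [ht.1]
end
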